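/- Let n > 3 and let f, f' be quadratic crooked functions over K = F_{2^n}. Then the parallelisms Π_f and Π_{f'} are equivalent — i.e. there exist a bijection σ of K with σ(0) = 0 and an F_2-linear bijection κ of K × F_2 such that σ(c_{f'}(p, q)) = c_f(κ(p), κ(q)) for all p, q ∈ K × F_2 — if and only if f and f' are affine equivalent via linear maps: there exist F_2-linear bijections σ', A of K and an element α ∈ K such that f'(x) = σ'(f(A(x) + α)) + σ'(f(α)) for all x ∈ K. -/

import Mathlib

/-- A crooked function on `K = F_{2^n}`. -/
def Crooked (n : ℕ) (f : GaloisField 2 n → GaloisField 2 n) : Prop :=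
  f 0 = 0 ∧
  (∀ x y z : GaloisField 2 n, x ≠ y → y ≠ z → x ≠ z →
    f x + f y + f z + f (x + y + z) ≠ 0) ∧
  (∀ a : GaloisField 2 n, a ≠ 0 → ∀ x y z : GaloisField 2 n,
    f x + f y + f z + f (x + a) + f (y + a) + f (z + a) ≠ 0)

/-- The coloring function `c_f` on `(K × F_2) × (K × F_2)`. -/
noncomputable def cf (n : ℕ) (f : GaloisField 2 n → GaloisField 2 n)
    (p q : GaloisField 2 n × ZMod 2) : GaloisField 2 n :=
  f (p.1 + q.1) + f p.1 + f q.1 + f (p.2 • q.1 + q.2 • p.1)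

/-- The symmetric bivariate function `B_f(x,y) = f(x+y) + f(x) + f(y)`. -/
noncomputable def Bf (n : ℕ) (f : GaloisField 2 n → GaloisField 2 n)
    (x y : GaloisField 2 n) : GaloisField 2 n :=
  f (x + y) + f x + f y

/-- `f` is quadratic: `B_f` is additive in each argument. -/
def IsQuadratic (n : ℕ) (f : GaloisField 2 n → GaloisField 2 n) : Prop :=
  (∀ x y z : GaloisField 2 n, Bf n f (x + y) z = Bf n f x z + Bf n f y z) ∧
  (∀ x y z : GaloisField 2 n, Bf n f x (y + z) = Bf n f x y + Bf n f x z)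

/-- `f` is almost perfect nonlinear. -/
def IsAPN (n : ℕ) (f : GaloisField 2 n → GaloisField 2 n) : Prop :=
  ∀ a : GaloisField 2 n, a ≠ 0 → ∀ b : GaloisField 2 n,
    {x : GaloisField 2 n | f (x + a) + f x = b}.ncard = 0 ∨
    {x : GaloisField 2 n | f (x + a) + f x = b}.ncard = 2

section

variable {n : ℕ} {f : GaloisField 2 n → GaloisField 2 n}

lemma zmod_two_eq_zero_or_one : ∀ t : ZMod 2, t = 0 ∨ t = 1 := by decide

lemma Crooked.eq_or_eq_of_Bf_eq_zero (hf : Crooked n f) {x y : GaloisField 2 n}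
    (hx : x ≠ 0) (h : Bf n f x y = 0) : y = 0 ∨ y = x := by
  by_contra! hy
  apply hf.2.1 x y 0 hy.2.symm hy.1 hx
  rw [hf.1, add_zero, add_zero, ← h, Bf]
  ring

lemma Crooked.Bf_ne_apply (hf : Crooked n f) {x : GaloisField 2 n} (hx : x ≠ 0)
    (y : GaloisField 2 n) : Bf n f x y + f x ≠ 0 := by
  intro h
  apply hf.2.2 x hx y 0 0
  rw [Bf] at h
  rw [hf.1, zero_add, add_comm y x]
  linear_combination h

lemma Crooked.Bf_zero_left (hf : Crooked n f) (y : GaloisField 2 n) : Bf n f 0 y = 0 := by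
  rw [Bf, zero_add, hf.1, add_zero, CharTwo.add_self_eq_zero]

lemma Bf_comm (x y : GaloisField 2 n) : Bf n f x y = Bf n f y x := by
  rw [Bf, Bf, add_comm x y]
  ring

lemma apply_add_eq (f : GaloisField 2 n → GaloisField 2 n) (x y : GaloisField 2 n) : f (x + y) = Bf n f x y + f x + f y := by
  rw [Bf]
  linear_combination (-f x - f y) * CharTwo.two_eq_zero (R := GaloisField 2 n)

lemma cf_eq (p q : GaloisField 2 n × ZMod 2) :
    cf n f p q = Bf n f p.1 q.1 + f (p.2 • q.1 + q.2 • p.1) := rfl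

lemma Crooked.apply_smul (hf : Crooked n f) (t : ZMod 2) (x : GaloisField 2 n) :
    f (t • x) = t • f x := by
  rcases zmod_two_eq_zero_or_one t with rfl | rfl <;> simp [hf.1]

lemma Crooked.cf_zero_right (hf : Crooked n f) (x : GaloisField 2 n)
    (q : GaloisField 2 n × ZMod 2) : cf n f (x, 0) q = Bf n f x q.1 + q.2 • f x := by
  simp [cf_eq, hf.apply_smul]

lemma Crooked.cf_zero_one (hf : Crooked n f) (y : GaloisField 2 n) :
    cf n f (0, 1) (y, 0) = f y := by
  simp [cf_eq, hf.Bf_zero_left]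

lemma Crooked.Bf_smul (hf : Crooked n f) (t : ZMod 2)
    (x y : GaloisField 2 n) : Bf n f (t • x) y = t • Bf n f x y := by
  rcases zmod_two_eq_zero_or_one t with rfl | rfl <;> simp [hf.Bf_zero_left]

/-- The coloring of the lines through a point at infinity is additive. -/
lemma IsQuadratic.cf_add (hfq : IsQuadratic n f) (hf : Crooked n f)
    {p : GaloisField 2 n × ZMod 2} (hp : p.2 = 0) (q r : GaloisField 2 n × ZMod 2) :
    cf n f p (q + r) = cf n f p q + cf n f p r := by
  obtain ⟨x, t⟩ := p
  obtain rfl : t = 0 := hp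
  simp only [hf.cf_zero_right, Prod.fst_add, Prod.snd_add, hfq.2, add_smul]
  ring

/-- Every color occurs on some line through a given point at infinity. -/
lemma IsQuadratic.cf_surjective (hfq : IsQuadratic n f) (hf : Crooked n f) (hn : n ≠ 0)
    {x : GaloisField 2 n} (hx : x ≠ 0) : Function.Surjective (cf n f (x, 0)) := by
  let L : (GaloisField 2 n × ZMod 2) →ₗ[ZMod 2] GaloisField 2 n :=
    AddMonoidHom.toZModLinearMap 2
      (AddMonoidHom.mk' (cf n f (x, 0)) (hfq.cf_add hf rfl))
  change Function.Surjective L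
  have hker : LinearMap.ker L ≤ Submodule.span (ZMod 2) {(x, 0)} := by
    rintro ⟨y, t⟩ hq
    have hq' : Bf n f x y + t • f x = 0 := by
      rw [← hf.cf_zero_right x (y, t)]
      exact hq
    rcases zmod_two_eq_zero_or_one t with rfl | rfl
    · rw [zero_smul, add_zero] at hq'
      rcases hf.eq_or_eq_of_Bf_eq_zero hx hq' with rfl | rfl
      · exact Submodule.zero_mem _
      · exact Submodule.mem_span_singleton_self _
    · rw [one_smul] at hq'
      exact absurd hq' (hf.Bf_ne_apply hx y)
  have hle : Module.finrank (ZMod 2) (LinearMap.ker L) ≤ 1 :=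
    (Submodule.finrank_mono hker).trans ((finrank_span_singleton (by simpa using hx)).le)
  have hrank := L.finrank_range_add_finrank_ker
  rw [Module.finrank_prod, Module.finrank_self, GaloisField.finrank 2 hn] at hrank
  rw [← LinearMap.range_eq_top]
  apply Submodule.eq_top_of_finrank_eq
  have := (LinearMap.range L).finrank_le
  rw [GaloisField.finrank 2 hn] at this ⊢
  omega

/-- The coloring of the lines through a point off the hyperplane at infinity is not additive. -/
lemma IsQuadratic.not_cf_add (hfq : IsQuadratic n f) (hf : Crooked n f) (hn : 1 < n)
    (x : GaloisField 2 n) : ∃ y z : GaloisField 2 n,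
      cf n f (x, 1) ((y, 0) + (z, 0)) ≠ cf n f (x, 1) (y, 0) + cf n f (x, 1) (z, 0) := by
  obtain ⟨z, hz, hz1⟩ : ∃ z : GaloisField 2 n, z ≠ 0 ∧ z ≠ 1 := by
    have hcard : 2 < Nat.card (GaloisField 2 n) := by
      rw [GaloisField.card 2 n (by omega)]
      calc 2 = 2 ^ 1 := rfl
        _ < 2 ^ n := Nat.pow_lt_pow_right (by norm_num) hn
    have := Fintype.ofFinite (GaloisField 2 n)
    classical
    rw [Nat.card_eq_fintype_card] at hcard
    obtain ⟨z, hz⟩ := Finset.exists_mem_notMem_of_card_lt_card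
      (s := ({0, 1} : Finset (GaloisField 2 n))) (t := Finset.univ)
      (Finset.card_le_two.trans_lt hcard)
    exact ⟨z, by simpa using hz.2⟩
  refine ⟨1, z, fun h => ?_⟩
  simp only [cf_eq, Prod.mk_add_mk, add_zero, one_smul, zero_smul, hfq.2,
    apply_add_eq f 1 z] at h
  have hB : Bf n f 1 z = 0 := by linear_combination h
  rcases hf.eq_or_eq_of_Bf_eq_zero one_ne_zero hB with h0 | h1
  exacts [hz h0, hz1 h1]

/-- An equivalence of parallelisms is additive on colors and preserves the hyperplane at
infinity. -/
lemma IsQuadratic.equivalence_additive {f' : GaloisField 2 n → GaloisField 2 n} (hn : 1 < n)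
    (hf : Crooked n f) (hfq : IsQuadratic n f) (hf' : Crooked n f') (hf'q : IsQuadratic n f')
    {σ : GaloisField 2 n → GaloisField 2 n}
    {κ : (GaloisField 2 n × ZMod 2) →ₗ[ZMod 2] (GaloisField 2 n × ZMod 2)}
    (hκ : Function.Bijective κ)
    (h : ∀ p q : GaloisField 2 n × ZMod 2, σ (cf n f' p q) = cf n f (κ p) (κ q)) :
    (∀ a b, σ (a + b) = σ a + σ b) ∧ ∀ x, (κ (x, 0)).2 = 0 := by
  have hadd : ∀ a b, σ (a + b) = σ a + σ b := by
    let φ : GaloisField 2 n →ₗ[ZMod 2] ZMod 2 :=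
      LinearMap.snd _ _ _ ∘ₗ κ ∘ₗ LinearMap.inl _ _ _
    have hφ : LinearMap.ker φ ≠ ⊥ := LinearMap.ker_ne_bot_of_finrank_lt (by
      rwa [Module.finrank_self, GaloisField.finrank 2 (by omega)])
    obtain ⟨x, hx, hx0⟩ := Submodule.exists_mem_ne_zero_of_ne_bot hφ
    have hx' : (κ (x, 0)).2 = 0 := hx
    intro a b
    obtain ⟨q, rfl⟩ := hf'q.cf_surjective hf' (by omega) hx0 a
    obtain ⟨r, rfl⟩ := hf'q.cf_surjective hf' (by omega) hx0 b
    rw [← hf'q.cf_add hf' rfl, h, h, h, map_add, hfq.cf_add hf hx']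
  refine ⟨hadd, fun x => ?_⟩
  by_contra hx
  have hx1 := (zmod_two_eq_zero_or_one _).resolve_left hx
  obtain ⟨y, z, hyz⟩ := hfq.not_cf_add hf hn (κ (x, 0)).1
  obtain ⟨q, hq⟩ := hκ.2 (y, 0)
  obtain ⟨r, hr⟩ := hκ.2 (z, 0)
  rw [← hq, ← hr, ← map_add, ← hx1, Prod.mk.eta, ← h, ← h, ← h,
    hf'q.cf_add hf' rfl, hadd] at hyz
  exact hyz rfl

end

theorem stmt_14 (n : ℕ) (hn : 3 < n)
    (f f' : GaloisField 2 n → GaloisField 2 n)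
    (hf : Crooked n f) (hfq : IsQuadratic n f)
    (hf' : Crooked n f') (hf'q : IsQuadratic n f') :
    (∃ (σ : GaloisField 2 n → GaloisField 2 n)
       (κ : (GaloisField 2 n × ZMod 2) →ₗ[ZMod 2] (GaloisField 2 n × ZMod 2)),
       Function.Bijective σ ∧ σ 0 = 0 ∧ Function.Bijective κ ∧
       ∀ p q : GaloisField 2 n × ZMod 2, σ (cf n f' p q) = cf n f (κ p) (κ q)) ↔
    (∃ (σ' A : GaloisField 2 n →ₗ[ZMod 2] GaloisField 2 n) (α : GaloisField 2 n),
       Function.Bijective σ' ∧ Function.Bijective A ∧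
       ∀ x : GaloisField 2 n, f' x = σ' (f (A x + α)) + σ' (f α)) := by
  constructor
  · rintro ⟨σ, κ, hσ, -, hκ, h⟩
    obtain ⟨hadd, hinf⟩ :=
      IsQuadratic.equivalence_additive (by omega) hf hfq hf' hf'q hκ h
    let S : GaloisField 2 n ≃ₗ[ZMod 2] GaloisField 2 n :=
      LinearEquiv.ofBijective (AddMonoidHom.toZModLinearMap 2 (AddMonoidHom.mk' σ hadd)) hσ
    have hS : ∀ x, S x = σ x := fun _ => rfl
    let A : GaloisField 2 n →ₗ[ZMod 2] GaloisField 2 n :=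
      LinearMap.fst _ _ _ ∘ₗ κ ∘ₗ LinearMap.inl _ _ _
    have hA : ∀ x, κ (x, 0) = (A x, 0) := fun x => Prod.ext rfl (hinf x)
    have hAinj : Function.Injective A := fun x y hxy => by
      have := hκ.1 (((hA x).trans (by rw [hxy])).trans (hA y).symm)
      exact congrArg Prod.fst this
    have hone : (κ (0, 1)).2 = 1 := by
      refine (zmod_two_eq_zero_or_one _).resolve_left fun h0 => ?_
      obtain ⟨⟨x, t⟩, hq⟩ := hκ.2 (0, 1)
      have hdecomp : ((x, t) : GaloisField 2 n × ZMod 2) = (x, 0) + t • (0, 1) := by simp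
      rw [hdecomp, map_add, map_smul] at hq
      have := congrArg Prod.snd hq
      simp [hinf, h0] at this
    refine ⟨S.symm, A, (κ (0, 1)).1, S.symm.bijective,
      ⟨hAinj, LinearMap.surjective_of_injective hAinj⟩, fun x => ?_⟩
    apply S.injective
    simp only [LinearEquiv.coe_coe, map_add, LinearEquiv.apply_symm_apply]
    rw [hS, ← hf'.cf_zero_one x, h, hA, cf_eq, hone, Bf_comm, apply_add_eq f (A x)]
    simp only [one_smul, zero_smul, add_zero]
    rw [add_assoc, CharTwo.add_self_eq_zero, add_zero]
  · rintro ⟨σ', A, α, hσ', hA, h⟩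
    let S : GaloisField 2 n ≃ₗ[ZMod 2] GaloisField 2 n := LinearEquiv.ofBijective σ' hσ'
    have hS : ∀ x, σ' x = S x := fun _ => rfl
    let κ : (GaloisField 2 n × ZMod 2) →ₗ[ZMod 2] (GaloisField 2 n × ZMod 2) :=
      LinearMap.prod (A.coprod (LinearMap.toSpanSingleton _ _ α)) (LinearMap.snd _ _ _)
    have hκ : ∀ x t, κ (x, t) = (A x + t • α, t) := fun x t => rfl
    have hf'S : ∀ x, f' x = S (Bf n f (A x) α + f (A x)) := fun x => by
      rw [h, hS, hS, ← map_add, apply_add_eq f (A x), add_assoc, CharTwo.add_self_eq_zero,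
        add_zero]
    have hB : ∀ x y, Bf n f' x y = S (Bf n f (A x) (A y)) := fun x y => by
      rw [Bf, hf'S, hf'S, hf'S, ← map_add, ← map_add, map_add A, hfq.1, apply_add_eq f (A x)]
      congr 1
      linear_combination (Bf n f (A x) α + Bf n f (A y) α + f (A x) + f (A y)) *
        CharTwo.two_eq_zero (R := GaloisField 2 n)
    refine ⟨S.symm, κ, S.symm.bijective, map_zero _, ⟨?_, ?_⟩, ?_⟩
    · rintro ⟨x, t⟩ ⟨y, s⟩ hxy
      rw [hκ, hκ, Prod.mk.injEq] at hxy
      obtain ⟨hxy, rfl⟩ := hxy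
      rw [hA.1 (add_right_cancel hxy)]
    · rintro ⟨y, t⟩
      obtain ⟨x, hx⟩ := hA.2 (y - t • α)
      exact ⟨(x, t), by rw [hκ, hx, sub_add_cancel]⟩
    · rintro ⟨x, t⟩ ⟨y, s⟩
      have hBr : ∀ (t : ZMod 2) (x y : GaloisField 2 n),
          Bf n f x (t • y) = t • Bf n f x y := fun t x y => by
        rw [Bf_comm, hf.Bf_smul, Bf_comm]
      have hαα : Bf n f α α = 0 := by
        rw [Bf, CharTwo.add_self_eq_zero, hf.1, zero_add, CharTwo.add_self_eq_zero]
      have harg : t • (A y + s • α) + s • (A x + t • α) = A (t • y + s • x) := by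
        simp only [smul_add, map_add, map_smul, smul_comm s t α]
        linear_combination (t • s • α) * CharTwo.two_eq_zero (R := GaloisField 2 n)
      rw [LinearEquiv.symm_apply_eq, hκ, hκ, cf_eq, cf_eq, hB, hf'S, ← map_add]
      simp only [harg]
      congr 1
      simp only [map_add, map_smul, hfq.1, hfq.2, hf.Bf_smul, hBr, hαα, smul_zero, add_zero,
        Bf_comm (f := f) α]
      ring
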